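/- Let d ≥ 3 and β ∈ (ℝ⁺)^d; write Ω(x,y) = ⟨x,y⟩_β and e(z) = e^{2πiz}. Fix a smooth function χ₀ : ℝ → [0,1] equal to 1 on [−1/2,1/2] and supported in [−1,1]; for z = (z¹,…,z^d) ∈ ℝ^d set χ₀(z) = χ₀(z¹)⋯χ₀(z^d), and set χ_∞ = 1 − χ₀ on ℝ. There is a constant C, depending only on d, β and χ₀, such that for every D > 0, every function Θ : ℝ^d × ℝ^d → ℂ all of whose partial derivatives ∂_x^α ∂_y^γ Θ of orders |α|, |γ| ≤ 10d exist, are continuous and are bounded in absolute value by D, every λ ≥ 1, every μ > 1 and all a, b, ξ, η ∈ ℝ^d: |∫_{ℝ^{2d}} Ω(x,y)⁻¹ χ_∞(μ Ω(x,y)) χ₀((x−a)/λ) χ₀((y−b)/λ) Θ(x,y) e(ξ·x + η·y) dx dy| ≤ C D λ^{2d}. Moreover, the limit of this integral as μ → ∞ exists, and its absolute value is at most C D λ^{2d}, uniformly in (a, b, ξ, η) ∈ ℝ^{4d}. -/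

import Mathlib

open MeasureTheory

namespace WKE

/-- Iterated directional derivative of `f` along the list of directions `vs` (outermost
direction first), built from the total Fréchet derivative. -/
noncomputable def pdList {E : Type*} [NormedAddCommGroup E] [NormedSpace ℝ E]
    (f : E → ℂ) : List E → E → ℂ
  | [] => f
  | v :: vs => fun z => fderiv ℝ (pdList f vs) z v

/-- The `j`-th coordinate direction in the `x` variable of `ℝ^d × ℝ^d`. -/
noncomputable def exv (d : ℕ) (j : Fin d) : (Fin d → ℝ) × (Fin d → ℝ) := (Pi.single j 1, 0)

/-- The `j`-th coordinate direction in the `y` variable of `ℝ^d × ℝ^d`. -/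
noncomputable def eyv (d : ℕ) (j : Fin d) : (Fin d → ℝ) × (Fin d → ℝ) := (0, Pi.single j 1)

/-- The oscillatory integral of Lemma A.8 (1) of Deng–Hani:
`∫_{ℝ^{2d}} Ω(x,y)⁻¹ χ_∞(μ Ω(x,y)) χ₀((x-a)/λ) χ₀((y-b)/λ) Θ(x,y) e(ξ·x + η·y) dx dy`,
where `Ω(x,y) = ⟨x,y⟩_β`, `χ_∞ = 1 - χ₀`, `χ₀` is extended to `ℝ^d` as a product, and
`e(z) = e^{2πiz}`. -/
noncomputable def oscInt (d : ℕ) (β : Fin d → ℝ) (χ₀ : ℝ → ℝ)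
    (Θ : (Fin d → ℝ) × (Fin d → ℝ) → ℂ) (lam μ : ℝ) (a b ξ η : Fin d → ℝ) : ℂ :=
  ∫ z : (Fin d → ℝ) × (Fin d → ℝ),
    (((∑ j, β j * z.1 j * z.2 j)⁻¹ * (1 - χ₀ (μ * ∑ j, β j * z.1 j * z.2 j)) *
        (∏ j, χ₀ ((z.1 j - a j) / lam)) * ∏ j, χ₀ ((z.2 j - b j) / lam) : ℝ) : ℂ) *
      Θ z *
      Complex.exp (2 * Real.pi * Complex.I *
        (((∑ j, ξ j * z.1 j) + ∑ j, η j * z.2 j : ℝ) : ℂ))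

section Aux

open Filter Topology

variable {χ₀ : ℝ → ℝ}

/-- The sine integral is bounded. -/
theorem sineInt_bound_one (x : ℝ) (hx : 0 ≤ x) : |∫ t in (0:ℝ)..x, Real.sinc t| ≤ 4 := by
  have hii : ∀ a b : ℝ, IntervalIntegrable Real.sinc volume a b :=
    fun a b => Real.continuous_sinc.intervalIntegrable a b
  have h1 : ∀ y : ℝ, 0 ≤ y → y ≤ 1 → |∫ t in (0:ℝ)..y, Real.sinc t| ≤ 1 := by
    intro y hy hy1
    have := intervalIntegral.norm_integral_le_of_norm_le_const (a := 0) (b := y) (C := 1)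
      (f := Real.sinc) (fun t _ => by simpa using Real.abs_sinc_le_one t)
    rw [Real.norm_eq_abs] at this
    refine this.trans ?_
    rw [sub_zero, abs_of_nonneg hy]; linarith
  rcases le_total x 1 with h | h
  · linarith [h1 x hx h]
  rw [← intervalIntegral.integral_add_adjacent_intervals (hii 0 1) (hii 1 x)]
  have hder : ∀ t ∈ Set.uIcc 1 x, HasDerivAt (fun t : ℝ => - (Real.cos t * t⁻¹))
      (Real.sinc t + Real.cos t * (t^2)⁻¹) t := by
    intro t ht
    rw [Set.uIcc_of_le h] at ht
    have ht0 : t ≠ 0 := by linarith [ht.1]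
    have := ((Real.hasDerivAt_cos t).mul (hasDerivAt_inv ht0)).neg
    refine HasDerivAt.congr_deriv (f' := -(-Real.sin t * t⁻¹ + Real.cos t * -(t ^ 2)⁻¹)) this ?_
    rw [Real.sinc_of_ne_zero ht0]; field_simp; ring
  have hcont : ContinuousOn (fun t : ℝ => (t^2)⁻¹) (Set.uIcc 1 x) := by
    rw [Set.uIcc_of_le h]
    intro t ht
    have ht0 : t ≠ 0 := by linarith [ht.1]
    exact (ContinuousAt.inv₀ (by fun_prop) (by positivity)).continuousWithinAt
  have hi2 : IntervalIntegrable (fun t : ℝ => (t^2)⁻¹) volume 1 x := hcont.intervalIntegrable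
  have hi3 : IntervalIntegrable (fun t : ℝ => Real.cos t * (t^2)⁻¹) volume 1 x :=
    (Real.continuous_cos.continuousOn.mul hcont).intervalIntegrable
  have e1 := intervalIntegral.integral_eq_sub_of_hasDerivAt hder ((hii 1 x).add hi3)
  rw [intervalIntegral.integral_add (hii 1 x) hi3] at e1
  have hder2 : ∀ t ∈ Set.uIcc 1 x, HasDerivAt (fun t : ℝ => - t⁻¹) ((t^2)⁻¹) t := by
    intro t ht
    rw [Set.uIcc_of_le h] at ht
    have ht0 : t ≠ 0 := by linarith [ht.1]
    have := (hasDerivAt_inv ht0).neg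
    exact HasDerivAt.congr_deriv (f' := -(-(t^2)⁻¹)) this (by ring)
  have e2 := intervalIntegral.integral_eq_sub_of_hasDerivAt hder2 hi2
  have e3 : ‖∫ t in (1:ℝ)..x, Real.cos t * (t^2)⁻¹‖ ≤ ∫ t in (1:ℝ)..x, (t^2)⁻¹ := by
    apply intervalIntegral.norm_integral_le_of_norm_le h _ hi2
    filter_upwards with t _
    rw [norm_mul, Real.norm_eq_abs, Real.norm_eq_abs, abs_of_nonneg (by positivity : 0 ≤ (t^2)⁻¹)]
    exact mul_le_of_le_one_left (by positivity) (Real.abs_cos_le_one t)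
  have hx0 : 0 < x⁻¹ := by positivity
  have hx1 : x⁻¹ ≤ 1 := inv_le_one_of_one_le₀ h
  have e4 : |Real.cos x * x⁻¹| ≤ x⁻¹ := by
    rw [abs_mul, abs_of_pos hx0]
    exact mul_le_of_le_one_left (by positivity) (Real.abs_cos_le_one x)
  have e5 := Real.abs_cos_le_one 1
  have e6 := h1 1 (by norm_num) le_rfl
  rw [Real.norm_eq_abs] at e3
  simp only [inv_one, mul_one] at e1 e2
  rw [abs_le] at *
  constructor <;> linarith [e3.1, e3.2, e4.1, e4.2, e5.1, e5.2, e6.1, e6.2]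

theorem sineInt_bound (x : ℝ) : |∫ t in (0:ℝ)..x, Real.sinc t| ≤ 4 := by
  rcases le_total 0 x with h | h
  · exact sineInt_bound_one x h
  · have := sineInt_bound_one (-x) (by linarith)
    have h2 := intervalIntegral.integral_comp_neg (a := 0) (b := x) Real.sinc
    simp only [Real.sinc_neg, neg_zero] at h2
    rw [h2, intervalIntegral.integral_symm, abs_neg]
    exact this

/-- The truncated kernel. -/
noncomputable def ker (χ₀ : ℝ → ℝ) (ν t : ℝ) : ℝ := t⁻¹ * (1 - χ₀ (ν * t))

structure Cut (χ₀ : ℝ → ℝ) : Prop where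
  cont : Continuous χ₀
  one : ∀ t : ℝ, |t| ≤ 1/2 → χ₀ t = 1
  zero : ∀ t : ℝ, 1 < |t| → χ₀ t = 0
  nonneg : ∀ t, 0 ≤ χ₀ t
  le : ∀ t, χ₀ t ≤ 1


theorem ker_meas (h : Cut χ₀) (ν : ℝ) : Measurable (ker χ₀ ν) := by
  have := h.cont.measurable
  unfold ker
  fun_prop

theorem ker_le_inv (h : Cut χ₀) (ν t : ℝ) : |ker χ₀ ν t| ≤ |t|⁻¹ := by
  unfold ker
  rw [abs_mul, abs_inv]
  apply mul_le_of_le_one_right (by positivity)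
  rw [abs_le]; constructor <;> linarith [h.nonneg (ν * t), h.le (ν * t)]

theorem ker_le_nu (h : Cut χ₀) (ν t : ℝ) : |ker χ₀ ν t| ≤ 2 * |ν| := by
  by_cases hs : |ν * t| ≤ 1/2
  · unfold ker; rw [h.one _ hs]; simp
  · push Not at hs
    refine (ker_le_inv h ν t).trans ?_
    have ht : 0 < |t| := by
      rw [abs_pos]; rintro rfl; simp at hs; linarith
    rw [abs_mul] at hs
    rw [inv_le_iff_one_le_mul₀ ht]
    linarith

theorem e_norm (x : ℝ) : ‖Complex.exp (Complex.I * x)‖ = 1 := by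
  rw [mul_comm]; exact Complex.norm_exp_ofReal_mul_I x

theorem kerint_ii (h : Cut χ₀) (ν ω a b : ℝ) :
    IntervalIntegrable (fun t : ℝ => (ker χ₀ ν t : ℂ) * Complex.exp (Complex.I * (ω * t : ℝ)))
      volume a b := by
  have hm := ker_meas h ν
  refine (intervalIntegrable_const (c := 2 * |ν|) (μ := volume)).mono_fun ?_ ?_
  · apply Measurable.aestronglyMeasurable
    fun_prop
  · filter_upwards with t
    rw [norm_mul, e_norm, mul_one, Complex.norm_real]
    simpa using ker_le_nu h ν t

theorem kerint_bound (h : Cut χ₀) (ν ω : ℝ) :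
    ‖∫ t in (-1:ℝ)..1, (ker χ₀ ν t : ℂ) * Complex.exp (Complex.I * (ω * t : ℝ))‖ ≤ 20 := by
  set f : ℝ → ℂ := fun t => (ker χ₀ ν t : ℂ) * Complex.exp (Complex.I * (ω * t : ℝ)) with hf
  have hii : ∀ a b, IntervalIntegrable f volume a b := fun a b => kerint_ii h ν ω a b
  have hfn : ∀ t, ‖f t‖ ≤ 2 * |ν| := by
    intro t
    simp only [hf]
    rw [norm_mul, e_norm, mul_one, Complex.norm_real]
    exact ker_le_nu h ν t
  have hfold : ∀ a : ℝ, ∫ t in (-1:ℝ)..(-a), f t = ∫ t in a..1, f (-t) := by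
    intro a
    rw [intervalIntegral.integral_comp_neg]
  by_cases hn : |ν| ≤ 1
  · have := intervalIntegral.norm_integral_le_of_norm_le_const (a := -1) (b := 1) (C := 2)
      (f := f) (fun t _ => by linarith [hfn t])
    refine this.trans ?_
    norm_num
  push Not at hn
  set n := |ν| with hndef
  have hn0 : 0 < n := by linarith
  rw [← intervalIntegral.integral_add_adjacent_intervals (hii (-1) (-n⁻¹)) (hii (-n⁻¹) 1),
    ← intervalIntegral.integral_add_adjacent_intervals (hii (-n⁻¹) (n⁻¹)) (hii (n⁻¹) 1), hfold]
  have hmid : ‖∫ t in (-n⁻¹)..n⁻¹, f t‖ ≤ 4 := by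
    refine (intervalIntegral.norm_integral_le_of_norm_le_const (C := 2 * n)
      (f := f) (fun t _ => hfn t)).trans ?_
    rw [abs_of_nonneg (by simp; positivity)]
    field_simp; norm_num
  have hn1 : n⁻¹ ≤ 1 := inv_le_one_of_one_le₀ hn.le
  have hii2 : IntervalIntegrable (fun t => f (-t)) volume n⁻¹ 1 := by
    have := hii (-n⁻¹) (-1)
    rw [IntervalIntegrable.iff_comp_neg] at this
    simpa using this
  have hout : (∫ t in n⁻¹..1, f (-t)) + ∫ t in n⁻¹..1, f t
      = 2 * Complex.I * (((∫ t in (0:ℝ)..ω, Real.sinc t) - (∫ t in (0:ℝ)..(ω * n⁻¹), Real.sinc t) : ℝ) : ℂ) := by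
    rw [← intervalIntegral.integral_add hii2 (hii _ _)]
    have hs : ∀ a b : ℝ, IntervalIntegrable Real.sinc volume a b :=
      fun a b => Real.continuous_sinc.intervalIntegrable a b
    rw [intervalIntegral.integral_interval_sub_left (hs _ _) (hs _ _)]
    have := intervalIntegral.mul_integral_comp_mul_left (a := n⁻¹) (b := 1) (f := Real.sinc) ω
    rw [mul_one] at this
    rw [← this, ← intervalIntegral.integral_const_mul, ← intervalIntegral.integral_ofReal,
      ← intervalIntegral.integral_const_mul]
    apply intervalIntegral.integral_congr_ae
    filter_upwards with t ht
    rw [Set.uIoc_of_le hn1] at ht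
    have ht0 : 0 < t := lt_trans (by positivity) ht.1
    have hνt : 1 < |ν * t| := by
      rw [abs_mul, ← hndef, abs_of_pos ht0]
      have := ht.1
      rwa [inv_lt_iff_one_lt_mul₀' hn0] at this
    have hνt' : 1 < |ν * -t| := by rwa [mul_neg, abs_neg]
    simp only [hf, ker]
    rw [h.zero _ hνt, h.zero _ hνt']
    rw [mul_comm Complex.I, mul_comm Complex.I, Complex.exp_mul_I, Complex.exp_mul_I]
    have hsin : ω * Real.sinc (ω * t) = Real.sin (ω * t) * t⁻¹ := by
      by_cases hω : ω = 0
      · simp [hω]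
      · rw [Real.sinc_of_ne_zero (by positivity)]
        field_simp
    rw [hsin]
    push_cast
    rw [mul_neg, Complex.cos_neg, Complex.sin_neg, inv_neg]
    ring
  have hout' : ‖(∫ t in n⁻¹..1, f (-t)) + ∫ t in n⁻¹..1, f t‖ ≤ 16 := by
    rw [hout, norm_mul, Complex.norm_real, norm_mul, Complex.norm_I, Real.norm_eq_abs]
    have := abs_sub (∫ t in (0:ℝ)..ω, Real.sinc t) (∫ t in (0:ℝ)..(ω * n⁻¹), Real.sinc t)
    have h1 := sineInt_bound ω
    have h2 := sineInt_bound (ω * n⁻¹)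
    norm_num
    linarith
  calc _ = ‖((∫ t in n⁻¹..1, f (-t)) + ∫ t in n⁻¹..1, f t) + ∫ t in (-n⁻¹)..n⁻¹, f t‖ := by
        congr 1; ring
    _ ≤ _ := norm_add_le _ _
    _ ≤ 20 := by linarith



theorem ker_one_scale (ν : ℝ) (hν : ν ≠ 0) :
    ∫ t in (-1:ℝ)..1, ker χ₀ ν t = ∫ s in (-ν)..ν, ker χ₀ 1 s := by
  have := intervalIntegral.mul_integral_comp_mul_left (a := -1) (b := 1) (f := ker χ₀ 1) ν
  rw [mul_one, mul_neg, mul_one] at this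
  rw [← this, ← intervalIntegral.integral_const_mul]
  congr 1; ext t
  simp only [ker, one_mul, mul_inv]
  field_simp

theorem ker_ii (h : Cut χ₀) (ν a b : ℝ) : IntervalIntegrable (ker χ₀ ν) volume a b := by
  refine (intervalIntegrable_const (c := 2 * |ν|) (μ := volume)).mono_fun
    (ker_meas h ν).aestronglyMeasurable ?_
  filter_upwards with t
  simpa using ker_le_nu h ν t

theorem ker_one_const (h : Cut χ₀) (ν : ℝ) (hν : 1 ≤ ν) :
    ∫ s in (-ν)..ν, ker χ₀ 1 s = ∫ s in (-1:ℝ)..1, ker χ₀ 1 s := by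
  have hii := fun a b => ker_ii h 1 a b
  rw [← intervalIntegral.integral_add_adjacent_intervals (hii (-ν) (-1)) (hii (-1) ν),
    ← intervalIntegral.integral_add_adjacent_intervals (hii (-1) 1) (hii 1 ν)]
  have : ∫ s in (-ν)..(-1), ker χ₀ 1 s = - ∫ s in (1:ℝ)..ν, ker χ₀ 1 s := by
    rw [← intervalIntegral.integral_comp_neg, ← intervalIntegral.integral_neg]
    apply intervalIntegral.integral_congr_ae
    filter_upwards with t ht
    rw [Set.uIoc_of_le hν] at ht
    have h1 : 1 < |1 * t| := by rw [one_mul, abs_of_pos (by linarith [ht.1])]; exact ht.1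
    have h2 : 1 < |1 * -t| := by rwa [mul_neg, abs_neg]
    simp only [ker]
    rw [h.zero _ h1, h.zero _ h2]
    simp [inv_neg]
  rw [this]; ring

theorem ker_lim (h : Cut χ₀) (p : ℝ) (hp : p ≠ 0) :
    ∃ l : ℝ, Tendsto (fun μ : ℝ => ∫ t in (-1:ℝ)..1, ker χ₀ (μ * p) t) atTop (𝓝 l) := by
  rcases lt_or_gt_of_ne hp with hp | hp
  · refine ⟨-∫ s in (-1:ℝ)..1, ker χ₀ 1 s, tendsto_const_nhds.congr' ?_⟩
    filter_upwards [eventually_ge_atTop (-p)⁻¹] with μ hμ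
    have h1 : 1 ≤ -(μ * p) := by
      rw [inv_le_iff_one_le_mul₀ (by linarith)] at hμ
      linarith
    rw [ker_one_scale (μ * p) (by intro h0; rw [h0] at h1; linarith),
      ← ker_one_const h _ h1, neg_neg, intervalIntegral.integral_symm, neg_neg]
  · refine ⟨∫ s in (-1:ℝ)..1, ker χ₀ 1 s, tendsto_const_nhds.congr' ?_⟩
    filter_upwards [eventually_ge_atTop p⁻¹] with μ hμ
    have h1 : 1 ≤ μ * p := by
      rw [inv_le_iff_one_le_mul₀ (by linarith)] at hμ
      linarith
    rw [ker_one_scale (μ * p) (by intro h0; rw [h0] at h1; linarith), ker_one_const h _ h1]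

/-- Pointwise limit of the kernel. -/
theorem ker_tendsto (h : Cut χ₀) (p : ℝ) (hp : p ≠ 0) (t : ℝ) :
    Tendsto (fun μ : ℝ => ker χ₀ (μ * p) t) atTop (𝓝 t⁻¹) := by
  by_cases ht : t = 0
  · subst ht; simp [ker]
  apply tendsto_const_nhds.congr'
  filter_upwards [eventually_gt_atTop (|p * t|⁻¹)] with μ hμ
  have hpt : 0 < |p * t| := by positivity
  have hμ0 : 0 < μ := lt_trans (by positivity) hμ
  rw [inv_lt_iff_one_lt_mul₀ hpt] at hμ
  unfold ker
  rw [h.zero]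
  · simp
  · rw [mul_assoc, abs_mul, abs_of_pos hμ0]; exact hμ

/-- Kernel integral with modulation: limit. -/
theorem kerint_lim (h : Cut χ₀) (p ω : ℝ) (hp : p ≠ 0) :
    ∃ l : ℂ, Tendsto (fun μ : ℝ => ∫ t in (-1:ℝ)..1, (ker χ₀ (μ * p) t : ℂ) *
      Complex.exp (Complex.I * (ω * t : ℝ))) atTop (𝓝 l) := by
  obtain ⟨l, hl⟩ := ker_lim h p hp
  have h1 : Tendsto (fun μ : ℝ => ∫ t in (-1:ℝ)..1, (ker χ₀ (μ * p) t : ℂ) *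
      (Complex.exp (Complex.I * (ω * t : ℝ)) - 1)) atTop
      (𝓝 (∫ t in (-1:ℝ)..1, ((t⁻¹ : ℝ) : ℂ) * (Complex.exp (Complex.I * (ω * t : ℝ)) - 1))) := by
    apply intervalIntegral.tendsto_integral_filter_of_dominated_convergence (fun _ => |ω|)
    · filter_upwards with μ
      have := ker_meas h (μ * p)
      apply Measurable.aestronglyMeasurable
      fun_prop
    · filter_upwards with μ
      filter_upwards with t _
      rw [norm_mul, Complex.norm_real, Real.norm_eq_abs]
      have h2 : ‖Complex.exp (Complex.I * (ω * t : ℝ)) - 1‖ ≤ |ω * t| :=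
        Real.norm_exp_I_mul_ofReal_sub_one_le
      by_cases ht : t = 0
      · subst ht; simp [ker]
      have ht' : 0 < |t| := by positivity
      calc _ ≤ |t|⁻¹ * |ω * t| := by
            gcongr
            exact ker_le_inv h _ _
        _ = |ω| := by rw [abs_mul]; field_simp
    · exact intervalIntegrable_const
    · filter_upwards with t _
      have := (Complex.continuous_ofReal.tendsto _).comp (ker_tendsto h p hp t)
      exact this.mul_const _
  refine ⟨_, (h1.add ((Complex.continuous_ofReal.tendsto _).comp hl)).congr ?_⟩
  intro μ
  simp only [Function.comp]
  rw [← intervalIntegral.integral_ofReal, ← intervalIntegral.integral_add]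
  · congr 1; ext t; ring
  · have := (kerint_ii h (μ * p) ω (-1) 1).sub (kerint_ii h (μ * p) 0 (-1) 1)
    simp only [zero_mul, Complex.ofReal_zero, mul_zero, Complex.exp_zero, mul_one] at this
    refine this.congr ?_
    intro t _
    simp only []
    ring
  · have := (kerint_ii h (μ * p) 0 (-1) 1)
    simpa using this

/-- Admissible amplitudes. -/
structure Amp (M lam s : ℝ) (g : ℝ → ℂ) : Prop where
  bd : ∀ t, ‖g t‖ ≤ M
  lip : ∀ t t', ‖g t - g t'‖ ≤ M * |t - t'|
  supp : ∀ t, lam < |t - s| → g t = 0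

theorem Amp.cont {M lam s : ℝ} {g : ℝ → ℂ} (hg : Amp M lam s g) : Continuous g := by
  have hM : 0 ≤ M := (norm_nonneg _).trans (hg.bd 0)
  have : LipschitzWith ⟨M, hM⟩ g := by
    apply LipschitzWith.of_dist_le_mul
    intro x y
    rw [dist_eq_norm, Real.dist_eq]
    exact hg.lip x y
  exact this.continuous

/-- the dominating function -/
noncomputable def dom (M lam s : ℝ) (t : ℝ) : ℝ :=
  (Set.Icc (-1:ℝ) 1).indicator (fun _ => M) t + (Set.Icc (s - lam) (s + lam)).indicator (fun _ => M) t

theorem dom_int (M lam s : ℝ) : Integrable (dom M lam s) := by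
  unfold dom
  apply Integrable.add
  · rw [integrable_indicator_iff measurableSet_Icc]
    exact integrableOn_const (by simp)
  · rw [integrable_indicator_iff measurableSet_Icc]
    exact integrableOn_const (by simp)

theorem dom_integral (M lam s : ℝ) (hlam : 1 ≤ lam) : ∫ t, dom M lam s t = 2 * M + 2 * lam * M := by
  unfold dom
  rw [integral_add]
  · rw [integral_indicator measurableSet_Icc, integral_indicator measurableSet_Icc,
      setIntegral_const, setIntegral_const, Real.volume_real_Icc_of_le (by linarith),
      Real.volume_real_Icc_of_le (by linarith)]
    simp only [smul_eq_mul]; ring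
  · rw [integrable_indicator_iff measurableSet_Icc]
    exact integrableOn_const (by simp)
  · rw [integrable_indicator_iff measurableSet_Icc]
    exact integrableOn_const (by simp)

noncomputable def rem (χ₀ : ℝ → ℝ) (g : ℝ → ℂ) (ω ν t : ℝ) : ℂ :=
  (ker χ₀ ν t : ℂ) * ((g t - (Set.Ioc (-1:ℝ) 1).indicator (fun _ => g 0) t) *
    Complex.exp (Complex.I * (ω * t : ℝ)))

theorem rem_le (h : Cut χ₀) {M lam s : ℝ} {g : ℝ → ℂ} (hg : Amp M lam s g) (ω ν t : ℝ) :
    ‖rem χ₀ g ω ν t‖ ≤ dom M lam s t := by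
  have hM : 0 ≤ M := (norm_nonneg _).trans (hg.bd 0)
  unfold rem dom
  rw [norm_mul, norm_mul, e_norm, mul_one, Complex.norm_real, Real.norm_eq_abs]
  have hk := ker_le_inv h ν t
  have hnn : ∀ (S : Set ℝ), 0 ≤ S.indicator (fun _ => M) t :=
    fun S => Set.indicator_nonneg (fun _ _ => hM) t
  by_cases ht : t ∈ Set.Ioc (-1:ℝ) 1
  · rw [Set.indicator_of_mem ht, Set.indicator_of_mem (Set.Ioc_subset_Icc_self ht)]
    have h1 := hg.lip t 0
    rw [sub_zero] at h1
    by_cases ht0 : t = 0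
    · subst ht0; simp; linarith [hnn (Set.Icc (s - lam) (s + lam))]
    have : 0 < |t| := by positivity
    have : |ker χ₀ ν t| * ‖g t - g 0‖ ≤ |t|⁻¹ * (M * |t|) := by gcongr
    have e : |t|⁻¹ * (M * |t|) = M := by field_simp
    linarith [hnn (Set.Icc (s - lam) (s + lam))]
  · rw [Set.indicator_of_notMem ht, sub_zero]
    by_cases hs : lam < |t - s|
    · rw [hg.supp t hs]; simp; linarith [hnn (Set.Icc (s - lam) (s + lam)), hnn (Set.Icc (-1) 1)]
    · have hs' : t ∈ Set.Icc (s - lam) (s + lam) := by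
        push Not at hs
        rw [abs_le] at hs
        constructor <;> linarith [hs.1, hs.2]
      rw [Set.indicator_of_mem hs']
      have h1 : 1 ≤ |t| := by
        by_contra hc
        push Not at hc
        rw [abs_lt] at hc
        exact ht ⟨hc.1, hc.2.le⟩
      have h2 : |t|⁻¹ ≤ 1 := inv_le_one_of_one_le₀ h1
      have : |ker χ₀ ν t| * ‖g t‖ ≤ 1 * M := by
        gcongr
        · linarith
        · exact hg.bd t
      linarith [hnn (Set.Icc (-1) 1)]

theorem rem_meas (h : Cut χ₀) {M lam s : ℝ} {g : ℝ → ℂ} (hg : Amp M lam s g) (ω ν : ℝ) :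
    AEStronglyMeasurable (rem χ₀ g ω ν) volume := by
  have h1 := ker_meas h ν
  have h2 := hg.cont.measurable
  have h3 : Measurable ((Set.Ioc (-1:ℝ) 1).indicator (fun _ => g 0)) :=
    measurable_const.indicator measurableSet_Ioc
  apply Measurable.aestronglyMeasurable
  unfold rem
  fun_prop

theorem oneD_split (h : Cut χ₀) {M lam s : ℝ} {g : ℝ → ℂ} (hg : Amp M lam s g) (ω ν : ℝ) :
    ∫ t, (ker χ₀ ν t : ℂ) * (g t * Complex.exp (Complex.I * (ω * t : ℝ))) =
      (∫ t, rem χ₀ g ω ν t) + g 0 * ∫ t in (-1:ℝ)..1, (ker χ₀ ν t : ℂ) *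
        Complex.exp (Complex.I * (ω * t : ℝ)) := by
  rw [intervalIntegral.integral_of_le (by norm_num), ← integral_const_mul,
    ← integral_indicator measurableSet_Ioc, ← integral_add]
  · congr 1; ext t
    unfold rem
    by_cases ht : t ∈ Set.Ioc (-1:ℝ) 1
    · rw [Set.indicator_of_mem ht, Set.indicator_of_mem ht]; ring
    · rw [Set.indicator_of_notMem ht, Set.indicator_of_notMem ht]; ring
  · exact (dom_int M lam s).mono' (rem_meas h hg ω ν) (Eventually.of_forall (rem_le h hg ω ν))
  · rw [integrable_indicator_iff measurableSet_Ioc]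
    have := (kerint_ii h ν ω (-1) 1).const_mul (g 0)
    rwa [intervalIntegrable_iff_integrableOn_Ioc_of_le (by norm_num)] at this

theorem oneD_bound (h : Cut χ₀) {M lam s : ℝ} (hlam : 1 ≤ lam) {g : ℝ → ℂ} (hg : Amp M lam s g)
    (ω ν : ℝ) :
    ‖∫ t, (ker χ₀ ν t : ℂ) * (g t * Complex.exp (Complex.I * (ω * t : ℝ)))‖ ≤ 24 * M * lam := by
  have hM : 0 ≤ M := (norm_nonneg _).trans (hg.bd 0)
  rw [oneD_split h hg]
  have h1 : ‖∫ t, rem χ₀ g ω ν t‖ ≤ 2 * M + 2 * lam * M := by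
    rw [← dom_integral M lam s hlam]
    exact norm_integral_le_of_norm_le (dom_int M lam s) (Eventually.of_forall (rem_le h hg ω ν))
  have h2 := kerint_bound h ν ω
  refine (norm_add_le _ _).trans ?_
  rw [norm_mul]
  have h3 : ‖g 0‖ * ‖∫ t in (-1:ℝ)..1, (ker χ₀ ν t : ℂ) *
        Complex.exp (Complex.I * (ω * t : ℝ))‖ ≤ M * 20 := by
    gcongr
    exact hg.bd 0
  nlinarith [mul_nonneg hM (sub_nonneg.mpr hlam)]

theorem oneD_lim (h : Cut χ₀) {M lam s : ℝ} {g : ℝ → ℂ} (hg : Amp M lam s g)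
    (ω p : ℝ) (hp : p ≠ 0) :
    ∃ l : ℂ, Tendsto (fun μ : ℝ => ∫ t, (ker χ₀ (μ * p) t : ℂ) *
      (g t * Complex.exp (Complex.I * (ω * t : ℝ)))) atTop (𝓝 l) := by
  obtain ⟨l, hl⟩ := kerint_lim h p ω hp
  have h1 : Tendsto (fun μ : ℝ => ∫ t, rem χ₀ g ω (μ * p) t) atTop
      (𝓝 (∫ t : ℝ, ((t⁻¹ : ℝ) : ℂ) * ((g t - (Set.Ioc (-1:ℝ) 1).indicator (fun _ => g 0) t) *
    Complex.exp (Complex.I * (ω * t : ℝ))))) := by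
    apply tendsto_integral_filter_of_dominated_convergence (dom M lam s)
    · exact Eventually.of_forall fun μ => rem_meas h hg ω _
    · exact Eventually.of_forall fun μ => Eventually.of_forall (rem_le h hg ω _)
    · exact dom_int M lam s
    · filter_upwards with t
      have := (Complex.continuous_ofReal.tendsto _).comp (ker_tendsto h p hp t)
      exact this.mul_const _
  refine ⟨_, (h1.add (hl.const_mul (g 0))).congr ?_⟩
  intro μ
  rw [oneD_split h hg]

theorem oneD_shift (g : ℝ → ℂ) (ω μ p c : ℝ) (hp : p ≠ 0) :
    ∫ y, (ker χ₀ μ (p * y + c) : ℂ) * (g y * Complex.exp (Complex.I * (ω * y : ℝ))) =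
    ((p⁻¹ : ℝ) * Complex.exp (Complex.I * (ω * (-(c / p)) : ℝ))) *
      ∫ t, (ker χ₀ (μ * p) t : ℂ) * (g (t + -(c / p)) * Complex.exp (Complex.I * (ω * t : ℝ))) := by
  rw [← integral_add_right_eq_self _ (-(c / p)), ← integral_const_mul]
  congr 1; ext t
  have e1 : p * (t + -(c / p)) + c = p * t := by field_simp; ring
  have e2 : ker χ₀ μ (p * t) = p⁻¹ * ker χ₀ (μ * p) t := by
    simp only [ker, mul_inv, mul_assoc]
  have e3 : Complex.exp (Complex.I * (ω * (t + -(c / p)) : ℝ)) =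
      Complex.exp (Complex.I * (ω * (-(c / p)) : ℝ)) * Complex.exp (Complex.I * (ω * t : ℝ)) := by
    rw [← Complex.exp_add]; congr 1; push_cast; ring
  rw [e1, e2, e3]; push_cast; ring

theorem Amp.shift {M lam s : ℝ} {g : ℝ → ℂ} (hg : Amp M lam s g) (r : ℝ) :
    Amp M lam (s - r) (fun t => g (t + r)) where
  bd t := hg.bd _
  lip t t' := by simpa using hg.lip (t + r) (t' + r)
  supp t ht := hg.supp _ (by convert ht using 2; ring)

theorem oneD_bound' (h : Cut χ₀) {M lam s : ℝ} (hlam : 1 ≤ lam) {g : ℝ → ℂ} (hg : Amp M lam s g)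
    (ω μ p c : ℝ) (hp : p ≠ 0) :
    ‖∫ y, (ker χ₀ μ (p * y + c) : ℂ) * (g y * Complex.exp (Complex.I * (ω * y : ℝ)))‖
      ≤ |p|⁻¹ * (24 * M * lam) := by
  rw [oneD_shift _ _ _ _ _ hp, norm_mul, norm_mul, e_norm, mul_one, Complex.norm_real, norm_inv,
    Real.norm_eq_abs]
  gcongr
  exact oneD_bound h hlam (hg.shift _) ω _

theorem oneD_lim' (h : Cut χ₀) {M lam s : ℝ} {g : ℝ → ℂ} (hg : Amp M lam s g)
    (ω p c : ℝ) (hp : p ≠ 0) :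
    ∃ l : ℂ, Tendsto (fun μ : ℝ => ∫ y, (ker χ₀ μ (p * y + c) : ℂ) *
      (g y * Complex.exp (Complex.I * (ω * y : ℝ)))) atTop (𝓝 l) := by
  obtain ⟨l, hl⟩ := oneD_lim h (hg.shift (-(c / p))) ω p hp
  refine ⟨_, (hl.const_mul ((p⁻¹ : ℝ) * Complex.exp (Complex.I * (ω * (-(c / p)) : ℝ)))).congr ?_⟩
  intro μ
  rw [oneD_shift _ _ _ _ _ hp]

theorem integrable_of_bdd_supp {α : Type*} [MeasurableSpace α] {m : Measure α} {S : Set α}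
    (hS : MeasurableSet S) (hfin : m S ≠ ⊤) {H : α → ℂ} (hH : AEStronglyMeasurable H m) {B : ℝ}
    (hB : ∀ z, ‖H z‖ ≤ B) (h0 : ∀ z, z ∉ S → H z = 0) : Integrable H m := by
  have hi : Integrable (S.indicator (fun _ => B)) m := by
    rw [integrable_indicator_iff hS]
    exact integrableOn_const hfin
  refine hi.mono' hH (Eventually.of_forall fun z => ?_)
  by_cases hz : z ∈ S
  · rw [Set.indicator_of_mem hz]; exact hB z
  · rw [Set.indicator_of_notMem hz, h0 z hz]; simp

/-- closed box -/
def box {n : ℕ} (b : Fin n → ℝ) (lam : ℝ) : Set (Fin n → ℝ) :=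
  Set.Icc (fun k => b k - lam) (fun k => b k + lam)

theorem not_mem_box {n : ℕ} {b : Fin n → ℝ} {lam : ℝ} {y : Fin n → ℝ} (hy : y ∉ box b lam) :
    ∃ k, lam < |y k - b k| := by
  by_contra hc
  push Not at hc
  apply hy
  constructor <;> intro k <;> have := abs_le.mp (hc k) <;> simp only <;> linarith [this.1, this.2]

theorem box_meas {n : ℕ} (b : Fin n → ℝ) (lam : ℝ) : MeasurableSet (box b lam) := measurableSet_Icc

theorem box_fin {n : ℕ} (b : Fin n → ℝ) (lam : ℝ) : volume (box b lam) ≠ ⊤ :=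
  (isCompact_Icc.measure_lt_top).ne

theorem box_vol {n : ℕ} (b : Fin n → ℝ) (lam : ℝ) (hlam : 0 ≤ lam) :
    volume.real (box b lam) = (2 * lam) ^ n := by
  unfold box Measure.real
  rw [Real.volume_Icc_pi_toReal (fun k => by simp only; linarith)]
  rw [Finset.prod_congr rfl (fun k _ => show b k + lam - (b k - lam) = 2 * lam by ring)]
  simp

/-- the `y` integrand -/
noncomputable def yint (χ₀ : ℝ → ℝ) {n : ℕ} (Ψ : (Fin n → ℝ) → ℂ) (q η : Fin n → ℝ) (μ : ℝ)
    (y : Fin n → ℝ) : ℂ :=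
  (ker χ₀ μ (∑ k, q k * y k) : ℂ) * (Ψ y * Complex.exp (Complex.I * (∑ k, η k * y k : ℝ)))

structure AmpN {n : ℕ} (M lam : ℝ) (b : Fin n → ℝ) (Ψ : (Fin n → ℝ) → ℂ) : Prop where
  meas : Measurable Ψ
  bd : ∀ y, ‖Ψ y‖ ≤ M
  supp : ∀ y k, lam < |y k - b k| → Ψ y = 0

theorem yint_meas (h : Cut χ₀) {n : ℕ} {M lam : ℝ} {b : Fin n → ℝ} {Ψ : (Fin n → ℝ) → ℂ}
    (hΨ : AmpN M lam b Ψ) (q η : Fin n → ℝ) (μ : ℝ) : Measurable (yint χ₀ Ψ q η μ) := by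
  have h1 := hΨ.meas
  have h2 := ker_meas h μ
  unfold yint
  fun_prop

theorem yint_le (h : Cut χ₀) {n : ℕ} {M lam : ℝ} {b : Fin n → ℝ} {Ψ : (Fin n → ℝ) → ℂ}
    (hΨ : AmpN M lam b Ψ) (q η : Fin n → ℝ) (μ : ℝ) (y) : ‖yint χ₀ Ψ q η μ y‖ ≤ 2 * |μ| * M := by
  unfold yint
  rw [norm_mul, norm_mul, e_norm, mul_one, Complex.norm_real, Real.norm_eq_abs]
  gcongr
  · exact ker_le_nu h _ _
  · exact hΨ.bd y

theorem yint_integrable (h : Cut χ₀) {n : ℕ} {M lam : ℝ} {b : Fin n → ℝ} {Ψ : (Fin n → ℝ) → ℂ}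
    (hΨ : AmpN M lam b Ψ) (q η : Fin n → ℝ) (μ : ℝ) : Integrable (yint χ₀ Ψ q η μ) := by
  apply integrable_of_bdd_supp (box_meas b lam) (box_fin b lam)
    (yint_meas h hΨ q η μ).aestronglyMeasurable (yint_le h hΨ q η μ)
  intro y hy
  obtain ⟨k, hk⟩ := not_mem_box hy
  simp [yint, hΨ.supp y k hk]

/-- inner integral in the `j`-th variable -/
noncomputable def inn (χ₀ : ℝ → ℝ) {n : ℕ} (j : Fin (n+1)) (Ψ : (Fin (n+1) → ℝ) → ℂ)
    (q η : Fin (n+1) → ℝ) (μ : ℝ) (y' : Fin n → ℝ) : ℂ :=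
  ∫ t : ℝ, yint χ₀ Ψ q η μ (j.insertNth t y')

theorem yint_fubini (h : Cut χ₀) {n : ℕ} {M lam : ℝ} {b : Fin (n+1) → ℝ}
    {Ψ : (Fin (n+1) → ℝ) → ℂ} (hΨ : AmpN M lam b Ψ) (j : Fin (n+1)) (q η : Fin (n+1) → ℝ) (μ : ℝ) :
    (∫ y, yint χ₀ Ψ q η μ y = ∫ y', inn χ₀ j Ψ q η μ y') ∧ Integrable (inn χ₀ j Ψ q η μ) := by
  have hmp := (volume_preserving_piFinSuccAbove (fun _ : Fin (n+1) => ℝ) j).symm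
  have hi : Integrable (fun z : ℝ × (Fin n → ℝ) => yint χ₀ Ψ q η μ (j.insertNth z.1 z.2))
      (volume.prod volume) := by
    have := (hmp.integrable_comp_emb (MeasurableEquiv.measurableEmbedding _)).mpr
      (yint_integrable h hΨ q η μ)
    exact this
  constructor
  · rw [← hmp.integral_comp']
    exact integral_prod_symm _ hi
  · exact hi.integral_prod_right

theorem inn_eq {n : ℕ} (j : Fin (n+1)) (Ψ : (Fin (n+1) → ℝ) → ℂ)
    (q η : Fin (n+1) → ℝ) (μ : ℝ) (y' : Fin n → ℝ) :
    inn χ₀ j Ψ q η μ y' = Complex.exp (Complex.I * (∑ k, η (j.succAbove k) * y' k : ℝ)) *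
      ∫ t : ℝ, (ker χ₀ μ (q j * t + ∑ k, q (j.succAbove k) * y' k) : ℂ) *
      (Ψ (j.insertNth t y') * Complex.exp (Complex.I * (η j * t : ℝ))) := by
  unfold inn yint
  rw [← integral_const_mul]
  congr 1; ext t
  simp only [Fin.sum_univ_succAbove _ j, Fin.insertNth_apply_same, Fin.insertNth_apply_succAbove]
  rw [Complex.ofReal_add (η j * t), mul_add, Complex.exp_add]
  ring

theorem inn_bound (h : Cut χ₀) {n : ℕ} {M lam : ℝ} (hlam : 1 ≤ lam) {b : Fin (n+1) → ℝ}
    {Ψ : (Fin (n+1) → ℝ) → ℂ} (hΨ : AmpN M lam b Ψ) (j : Fin (n+1))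
    (hamp : ∀ y' : Fin n → ℝ, Amp M lam (b j) (fun t => Ψ (j.insertNth t y')))
    (q η : Fin (n+1) → ℝ) (hq : q j ≠ 0) (μ : ℝ) (y' : Fin n → ℝ) :
    ‖inn χ₀ j Ψ q η μ y'‖ ≤
      (box (fun k => b (j.succAbove k)) lam).indicator (fun _ => |q j|⁻¹ * (24 * M * lam)) y' := by
  by_cases hy : y' ∈ box (fun k => b (j.succAbove k)) lam
  · rw [Set.indicator_of_mem hy, inn_eq, norm_mul, e_norm, one_mul]
    exact oneD_bound' h hlam (hamp y') _ _ _ _ hq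
  · rw [Set.indicator_of_notMem hy]
    obtain ⟨k, hk⟩ := not_mem_box hy
    have : ∀ t : ℝ, Ψ (j.insertNth t y') = 0 := by
      intro t
      apply hΨ.supp _ (j.succAbove k)
      simpa using hk
    simp [inn, yint, this]

theorem nD_bound (h : Cut χ₀) {n : ℕ} {M lam : ℝ} (hlam : 1 ≤ lam) {b : Fin (n+1) → ℝ}
    {Ψ : (Fin (n+1) → ℝ) → ℂ} (hΨ : AmpN M lam b Ψ) (j : Fin (n+1))
    (hamp : ∀ y' : Fin n → ℝ, Amp M lam (b j) (fun t => Ψ (j.insertNth t y')))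
    (q η : Fin (n+1) → ℝ) (hq : q j ≠ 0) (μ : ℝ) :
    ‖∫ y, yint χ₀ Ψ q η μ y‖ ≤ (2 * lam) ^ n * (|q j|⁻¹ * (24 * M * lam)) := by
  rw [(yint_fubini h hΨ j q η μ).1]
  have hi : Integrable ((box (fun k => b (j.succAbove k)) lam).indicator
      (fun _ => |q j|⁻¹ * (24 * M * lam))) := by
    rw [integrable_indicator_iff (box_meas _ _)]
    exact integrableOn_const (box_fin _ _)
  refine (norm_integral_le_of_norm_le hi
    (Eventually.of_forall (inn_bound h hlam hΨ j hamp q η hq μ))).trans ?_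
  rw [integral_indicator (box_meas _ _), setIntegral_const, box_vol _ _ (by linarith), smul_eq_mul]

theorem nD_lim (h : Cut χ₀) {n : ℕ} {M lam : ℝ} (hlam : 1 ≤ lam) {b : Fin (n+1) → ℝ}
    {Ψ : (Fin (n+1) → ℝ) → ℂ} (hΨ : AmpN M lam b Ψ) (j : Fin (n+1))
    (hamp : ∀ y' : Fin n → ℝ, Amp M lam (b j) (fun t => Ψ (j.insertNth t y')))
    (q η : Fin (n+1) → ℝ) (hq : q j ≠ 0) :
    ∃ l : ℂ, Tendsto (fun μ => ∫ y, yint χ₀ Ψ q η μ y) atTop (𝓝 l) := by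
  have hl : ∀ y' : Fin n → ℝ, ∃ l : ℂ, Tendsto (fun μ => inn χ₀ j Ψ q η μ y') atTop (𝓝 l) := by
    intro y'
    obtain ⟨l, hl⟩ := oneD_lim' h (hamp y') (η j) (q j) (∑ k, q (j.succAbove k) * y' k) hq
    refine ⟨_, (hl.const_mul (Complex.exp (Complex.I * (∑ k, η (j.succAbove k) * y' k : ℝ)))).congr ?_⟩
    intro μ
    rw [inn_eq]
  choose l hl using hl
  have hi : Integrable ((box (fun k => b (j.succAbove k)) lam).indicator
      (fun _ => |q j|⁻¹ * (24 * M * lam))) := by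
    rw [integrable_indicator_iff (box_meas _ _)]
    exact integrableOn_const (box_fin _ _)
  refine ⟨∫ y', l y', ?_⟩
  simp_rw [fun μ => (yint_fubini h hΨ j q η μ).1]
  apply tendsto_integral_filter_of_dominated_convergence _ _ _ hi
  · exact Eventually.of_forall hl
  · exact Eventually.of_forall fun μ => (yint_fubini h hΨ j q η μ).2.aestronglyMeasurable
  · exact Eventually.of_forall fun μ =>
      (Eventually.of_forall (inn_bound h hlam hΨ j hamp q η hq μ))

theorem integrableOn_sqrt_inv :
    IntegrableOn (fun t : ℝ => |t| ^ (-(1/2) : ℝ)) (Set.Icc (-1:ℝ) 1) := by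
  have h1 : IntervalIntegrable (fun t : ℝ => |t| ^ (-(1/2) : ℝ)) volume 0 1 := by
    refine (intervalIntegral.intervalIntegrable_rpow' (r := -(1/2)) (by norm_num)).congr ?_
    intro t ht
    rw [Set.uIoc_of_le (by norm_num)] at ht
    simp only [abs_of_pos ht.1]
  have h2 : IntervalIntegrable (fun t : ℝ => |t| ^ (-(1/2) : ℝ)) volume (-1) 0 := by
    have := h1
    rw [IntervalIntegrable.iff_comp_neg] at this
    simp only [abs_neg, neg_zero] at this
    exact this.symm
  have := h2.trans h1
  rwa [intervalIntegrable_iff_integrableOn_Icc_of_le (by norm_num)] at this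

/-- one-dimensional weight -/
noncomputable def wt (lam a t : ℝ) : ℝ :=
  (Set.Icc (a - lam) (a + lam)).indicator (fun _ => 1) t +
    (Set.Icc (-1:ℝ) 1).indicator (fun t : ℝ => |t| ^ (-(1/2) : ℝ)) t

noncomputable def c0 : ℝ := ∫ t in Set.Icc (-1:ℝ) 1, |t| ^ (-(1/2) : ℝ)

theorem c0_nonneg : 0 ≤ c0 := integral_nonneg fun t => by positivity

theorem wt_integrable (lam a : ℝ) : Integrable (wt lam a) := by
  apply Integrable.add
  · rw [integrable_indicator_iff measurableSet_Icc]
    exact integrableOn_const (by simp)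
  · rw [integrable_indicator_iff measurableSet_Icc]
    exact integrableOn_sqrt_inv

theorem wt_integral (lam a : ℝ) (hlam : 1 ≤ lam) : ∫ t, wt lam a t ≤ (2 + c0) * lam := by
  unfold wt
  rw [integral_add]
  · rw [integral_indicator measurableSet_Icc, integral_indicator measurableSet_Icc,
      setIntegral_const, Real.volume_real_Icc_of_le (by linarith)]
    have : (∫ t in Set.Icc (-1:ℝ) 1, |t| ^ (-(1/2) : ℝ)) = c0 := rfl
    rw [this, smul_eq_mul]
    nlinarith [c0_nonneg]
  · rw [integrable_indicator_iff measurableSet_Icc]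
    exact integrableOn_const (by simp)
  · rw [integrable_indicator_iff measurableSet_Icc]
    exact integrableOn_sqrt_inv

theorem wt_nonneg (lam a t : ℝ) : 0 ≤ wt lam a t := by
  unfold wt
  have h1 : 0 ≤ (Set.Icc (a - lam) (a + lam)).indicator (fun _ => (1:ℝ)) t :=
    Set.indicator_nonneg (fun _ _ => by norm_num) t
  have h2 : 0 ≤ (Set.Icc (-1:ℝ) 1).indicator (fun t : ℝ => |t| ^ (-(1/2) : ℝ)) t :=
    Set.indicator_nonneg (fun _ _ => by positivity) t
  linarith

theorem wt_ge_one {lam a t : ℝ} (ht : t ∈ Set.Icc (a - lam) (a + lam)) : 1 ≤ wt lam a t := by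
  unfold wt
  have h2 : 0 ≤ (Set.Icc (-1:ℝ) 1).indicator (fun t : ℝ => |t| ^ (-(1/2) : ℝ)) t :=
    Set.indicator_nonneg (fun _ _ => by positivity) t
  rw [Set.indicator_of_mem ht]
  linarith

theorem wt_ge {lam a t : ℝ} (ht : t ∈ Set.Icc (a - lam) (a + lam)) :
    |t| ^ (-(1/2) : ℝ) ≤ wt lam a t := by
  by_cases h : t ∈ Set.Icc (-1:ℝ) 1
  · unfold wt
    rw [Set.indicator_of_mem ht, Set.indicator_of_mem h]
    linarith
  · refine le_trans ?_ (wt_ge_one ht)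
    apply Real.rpow_le_one_of_one_le_of_nonpos
    · by_contra hc
      push Not at hc
      rw [abs_lt] at hc
      exact h ⟨hc.1.le, hc.2.le⟩
    · norm_num

theorem prod_wt_ge {n : ℕ} {lam : ℝ} {a x : Fin n → ℝ} (hx : x ∈ box a lam) {i j : Fin n}
    (hij : i ≠ j) :
    |x i| ^ (-(1/2) : ℝ) * |x j| ^ (-(1/2) : ℝ) ≤ ∏ k, wt lam (a k) (x k) := by
  have hk : ∀ k, x k ∈ Set.Icc (a k - lam) (a k + lam) := fun k => ⟨hx.1 k, hx.2 k⟩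
  rw [← Finset.mul_prod_erase _ _ (Finset.mem_univ i),
    ← Finset.mul_prod_erase _ _ (Finset.mem_erase.mpr ⟨hij.symm, Finset.mem_univ j⟩)]
  have h1 : 1 ≤ ∏ k ∈ (Finset.univ.erase i).erase j, wt lam (a k) (x k) := by
    rw [← Finset.prod_const_one (s := (Finset.univ.erase i).erase j)]
    exact Finset.prod_le_prod (fun _ _ => zero_le_one) (fun k _ => wt_ge_one (hk k))
  have h2 := wt_ge (hk i)
  have h3 := wt_ge (hk j)
  have h4 := wt_nonneg lam (a i) (x i)
  have h5 := wt_nonneg lam (a j) (x j)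
  gcongr
  exact h3.trans (le_mul_of_one_le_right h5 h1)

theorem geo_mean {X Q s t : ℝ} (hX : 0 ≤ X) (hQ : 0 ≤ Q) (hs : 0 < s) (ht : 0 < t)
    (h1 : X ≤ Q * s⁻¹) (h2 : X ≤ Q * t⁻¹) : X ≤ Q * (s ^ (-(1/2) : ℝ) * t ^ (-(1/2) : ℝ)) := by
  have e : ∀ u : ℝ, 0 < u → (u ^ (-(1/2) : ℝ)) ^ 2 = u⁻¹ := by
    intro u hu
    rw [← Real.rpow_natCast, ← Real.rpow_mul hu.le]
    norm_num
    exact Real.rpow_neg_one u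
  apply le_of_sq_le_sq _ (by positivity)
  calc X ^ 2 = X * X := sq X
    _ ≤ (Q * s⁻¹) * (Q * t⁻¹) := by gcongr
    _ = _ := by rw [mul_pow, mul_pow, e s hs, e t ht]; ring

/-- The `y`-amplitude for fixed `x`. -/
noncomputable def psi (χ₀ : ℝ → ℝ) {d : ℕ} (Θ : (Fin d → ℝ) × (Fin d → ℝ) → ℂ) (lam : ℝ)
    (a b ξ x y : Fin d → ℝ) : ℂ :=
  (((∏ k, χ₀ ((x k - a k) / lam) : ℝ) : ℂ) * Complex.exp (Complex.I * (2 * Real.pi * ∑ k, ξ k * x k : ℝ)))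
    * ((∏ k, χ₀ ((y k - b k) / lam) : ℝ) * Θ (x, y))

theorem osc_integrand_eq {d : ℕ} (β : Fin d → ℝ) (Θ : (Fin d → ℝ) × (Fin d → ℝ) → ℂ) (lam μ : ℝ)
    (a b ξ η : Fin d → ℝ) (z : (Fin d → ℝ) × (Fin d → ℝ)) :
    (((∑ j, β j * z.1 j * z.2 j)⁻¹ * (1 - χ₀ (μ * ∑ j, β j * z.1 j * z.2 j)) *
        (∏ j, χ₀ ((z.1 j - a j) / lam)) * ∏ j, χ₀ ((z.2 j - b j) / lam) : ℝ) : ℂ) *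
      Θ z *
      Complex.exp (2 * Real.pi * Complex.I *
        (((∑ j, ξ j * z.1 j) + ∑ j, η j * z.2 j : ℝ) : ℂ)) =
    yint χ₀ (psi χ₀ Θ lam a b ξ z.1) (fun k => β k * z.1 k) (fun k => 2 * Real.pi * η k) μ z.2 := by
  unfold yint psi ker
  have : Complex.exp (2 * Real.pi * Complex.I *
        (((∑ j, ξ j * z.1 j) + ∑ j, η j * z.2 j : ℝ) : ℂ)) =
      Complex.exp (Complex.I * (2 * Real.pi * ∑ k, ξ k * z.1 k : ℝ)) *
      Complex.exp (Complex.I * (∑ k, 2 * Real.pi * η k * z.2 k : ℝ)) := by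
    rw [← Complex.exp_add]
    congr 1
    simp only [mul_assoc, ← Finset.mul_sum]
    push_cast
    ring
  rw [this]
  push_cast
  ring

theorem prod_cut_le (h : Cut χ₀) {ι : Type*} (s : Finset ι) (f : ι → ℝ) :
    0 ≤ ∏ k ∈ s, χ₀ (f k) ∧ ∏ k ∈ s, χ₀ (f k) ≤ 1 :=
  ⟨Finset.prod_nonneg fun _ _ => h.nonneg _, Finset.prod_le_one (fun _ _ => h.nonneg _) fun _ _ => h.le _⟩

theorem prod_cut_zero (h : Cut χ₀) {d : ℕ} {lam : ℝ} (hlam : 1 ≤ lam) (b y : Fin d → ℝ) (k : Fin d)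
    (hk : lam < |y k - b k|) : ∏ k, χ₀ ((y k - b k) / lam) = 0 := by
  apply Finset.prod_eq_zero (Finset.mem_univ k)
  apply h.zero
  rw [abs_div, abs_of_pos (by linarith : 0 < lam), lt_div_iff₀ (by linarith)]
  linarith

theorem psi_pref (h : Cut χ₀) {d : ℕ} (lam : ℝ) (a ξ x : Fin d → ℝ) :
    ‖((∏ k, χ₀ ((x k - a k) / lam) : ℝ) : ℂ) *
      Complex.exp (Complex.I * (2 * Real.pi * ∑ k, ξ k * x k : ℝ))‖ ≤ 1 := by
  rw [norm_mul, e_norm, mul_one, Complex.norm_real, Real.norm_eq_abs]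
  have := prod_cut_le h Finset.univ (fun k => (x k - a k) / lam)
  rw [abs_of_nonneg this.1]; exact this.2

theorem psi_le (h : Cut χ₀) {d : ℕ} {Θ : (Fin d → ℝ) × (Fin d → ℝ) → ℂ} {D : ℝ}
    (hb : ∀ z, ‖Θ z‖ ≤ D) (lam : ℝ) (a b ξ x y : Fin d → ℝ) : ‖psi χ₀ Θ lam a b ξ x y‖ ≤ D := by
  unfold psi
  rw [norm_mul, norm_mul _ (Θ _), Complex.norm_real, Real.norm_eq_abs]
  have h2 := prod_cut_le h Finset.univ (fun k => (y k - b k) / lam)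
  rw [abs_of_nonneg h2.1]
  calc _ ≤ 1 * (1 * D) := by
        gcongr
        · exact mul_nonneg h2.1 (norm_nonneg _)
        · exact psi_pref h lam a ξ x
        · exact h2.2
        · exact hb _
    _ = D := by ring

theorem psi_ampN (h : Cut χ₀) {d : ℕ} {Θ : (Fin d → ℝ) × (Fin d → ℝ) → ℂ} {D M : ℝ}
    (hc : Continuous Θ) (hb : ∀ z, ‖Θ z‖ ≤ D) (hM : D ≤ M) {lam : ℝ} (hlam : 1 ≤ lam)
    (a b ξ x : Fin d → ℝ) : AmpN M lam b (psi χ₀ Θ lam a b ξ x) where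
  meas := by
    have := h.cont
    apply Continuous.measurable
    unfold psi
    fun_prop
  bd y := (psi_le h hb lam a b ξ x y).trans hM
  supp y k hk := by
    unfold psi
    rw [prod_cut_zero h hlam b y k hk]
    simp

theorem insertNth_line {n : ℕ} (j : Fin (n+1)) (t : ℝ) (y' : Fin n → ℝ) (x : Fin (n+1) → ℝ) :
    ((x, j.insertNth t y') : (Fin (n+1) → ℝ) × (Fin (n+1) → ℝ)) =
      (x, j.insertNth 0 y') + t • eyv (n+1) j := by
  unfold eyv
  ext k
  · simp
  · revert k
    rw [j.forall_iff_succAbove]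
    constructor
    · simp
    · intro k
      simp [Fin.succAbove_ne]

theorem theta_lip {n : ℕ} {Θ : (Fin (n+1) → ℝ) × (Fin (n+1) → ℝ) → ℂ} {D : ℝ} (j : Fin (n+1))
    (hd : Differentiable ℝ Θ) (hb : ∀ z, ‖fderiv ℝ Θ z (eyv (n+1) j)‖ ≤ D)
    (x : Fin (n+1) → ℝ) (y' : Fin n → ℝ) (t t' : ℝ) :
    ‖Θ (x, j.insertNth t y') - Θ (x, j.insertNth t' y')‖ ≤ D * |t - t'| := by
  rw [insertNth_line j t, insertNth_line j t']
  set z0 : (Fin (n+1) → ℝ) × (Fin (n+1) → ℝ) := (x, j.insertNth 0 y')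
  have hder : ∀ s : ℝ, HasDerivAt (fun s : ℝ => Θ (z0 + s • eyv (n+1) j))
      (fderiv ℝ Θ (z0 + s • eyv (n+1) j) (eyv (n+1) j)) s := by
    intro s
    have h1 : HasDerivAt (fun s : ℝ => z0 + s • eyv (n+1) j) (eyv (n+1) j) s := by
      have := ((hasDerivAt_id s).smul_const (eyv (n+1) j)).const_add z0
      simpa using this
    exact (hd _).hasFDerivAt.comp_hasDerivAt s h1
  have := Convex.norm_image_sub_le_of_norm_hasDerivWithin_le (s := Set.univ) (C := D) (x := t') (y := t)
    (fun s _ => (hder s).hasDerivWithinAt) (fun s _ => hb _) convex_univ trivial trivial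
  simpa using this

theorem psi_amp (h : Cut χ₀) {n : ℕ} {Θ : (Fin (n+1) → ℝ) × (Fin (n+1) → ℝ) → ℂ} {D S : ℝ}
    (hS : 0 ≤ S) (hSl : ∀ s t, |χ₀ s - χ₀ t| ≤ S * |s - t|)
    (hD : 0 ≤ D) (hd : Differentiable ℝ Θ) (hb : ∀ z, ‖Θ z‖ ≤ D) (j : Fin (n+1))
    (hb' : ∀ z, ‖fderiv ℝ Θ z (eyv (n+1) j)‖ ≤ D)
    {lam : ℝ} (hlam : 1 ≤ lam) (a b ξ x : Fin (n+1) → ℝ) (y' : Fin n → ℝ) :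
    Amp ((1 + S) * D) lam (b j) (fun t => psi χ₀ Θ lam a b ξ x (j.insertNth t y')) where
  bd t := (psi_le h hb lam a b ξ x _).trans (by nlinarith [mul_nonneg hS hD])
  supp t ht := by
    have h1 := psi_ampN h hd.continuous hb le_rfl hlam a b ξ x
    exact h1.supp _ j (by simpa using ht)
  lip t t' := by
    unfold psi
    rw [← mul_sub, norm_mul]
    have hR := prod_cut_le h Finset.univ (fun k => (y' k - b (j.succAbove k)) / lam)
    simp only [Fin.prod_univ_succAbove _ j, Fin.insertNth_apply_same, Fin.insertNth_apply_succAbove]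
    set R := ∏ k, χ₀ ((y' k - b (j.succAbove k)) / lam)
    set u := χ₀ ((t - b j) / lam) with hu
    set u' := χ₀ ((t' - b j) / lam) with hu'
    have e1 := theta_lip j hd hb' x y' t t'
    set θ := Θ (x, j.insertNth t y')
    set θ' := Θ (x, j.insertNth t' y') with hθ'
    have hθb : ‖θ'‖ ≤ D := hb _
    have e2 : |u - u'| ≤ S * |t - t'| := by
      refine (hSl _ _).trans ?_
      refine mul_le_mul_of_nonneg_left ?_ hS
      rw [← sub_div, abs_div, abs_of_pos (by linarith : 0 < lam)]
      rw [sub_sub_sub_cancel_right]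
      exact div_le_self (abs_nonneg _) hlam
    have hu0 : |u| ≤ 1 := by rw [abs_of_nonneg (h.nonneg _)]; exact h.le _
    have e3 : ((u * R : ℝ) : ℂ) * θ - ((u' * R : ℝ) : ℂ) * θ' =
        (R : ℂ) * ((u : ℂ) * (θ - θ') + ((u - u' : ℝ) : ℂ) * θ') := by push_cast; ring
    have e4 : ‖((u * R : ℝ) : ℂ) * θ - ((u' * R : ℝ) : ℂ) * θ'‖ ≤
        1 * (1 * (D * |t - t'|) + (S * |t - t'|) * D) := by
      rw [e3, norm_mul, Complex.norm_real, Real.norm_eq_abs, abs_of_nonneg hR.1]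
      refine mul_le_mul hR.2 ?_ (norm_nonneg _) zero_le_one
      refine (norm_add_le _ _).trans ?_
      rw [norm_mul, norm_mul, Complex.norm_real, Complex.norm_real, Real.norm_eq_abs,
        Real.norm_eq_abs]
      gcongr
    have hp := psi_pref h lam a ξ x
    rw [Fin.prod_univ_succAbove _ j] at hp
    calc _ ≤ 1 * (1 * (1 * (D * |t - t'|) + (S * |t - t'|) * D)) := by
          refine mul_le_mul hp (e4.trans (by rw [one_mul])) (norm_nonneg _) zero_le_one
      _ = _ := by ring

/-- The integral in `y` for fixed `x`. -/
noncomputable def Fx (χ₀ : ℝ → ℝ) {d : ℕ} (β : Fin d → ℝ) (Θ : (Fin d → ℝ) × (Fin d → ℝ) → ℂ)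
    (lam : ℝ) (a b ξ η : Fin d → ℝ) (μ : ℝ) (x : Fin d → ℝ) : ℂ :=
  ∫ y, yint χ₀ (psi χ₀ Θ lam a b ξ x) (fun k => β k * x k) (fun k => 2 * Real.pi * η k) μ y

theorem osc_fubini (h : Cut χ₀) {d : ℕ} (β : Fin d → ℝ) {Θ : (Fin d → ℝ) × (Fin d → ℝ) → ℂ} {D : ℝ}
    (hc : Continuous Θ) (hb : ∀ z, ‖Θ z‖ ≤ D) {lam : ℝ} (hlam : 1 ≤ lam)
    (a b ξ η : Fin d → ℝ) (μ : ℝ) :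
    oscInt d β χ₀ Θ lam μ a b ξ η = ∫ x, Fx χ₀ β Θ lam a b ξ η μ x ∧
      Integrable (Fx χ₀ β Θ lam a b ξ η μ) := by
  have hi : Integrable (fun z : (Fin d → ℝ) × (Fin d → ℝ) =>
      yint χ₀ (psi χ₀ Θ lam a b ξ z.1) (fun k => β k * z.1 k) (fun k => 2 * Real.pi * η k) μ z.2)
      (volume.prod volume) := by
    refine integrable_of_bdd_supp (S := box a lam ×ˢ box b lam)
      ((box_meas _ _).prod (box_meas _ _)) ?_ ?_ (B := 2 * |μ| * D) ?_ ?_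
    · rw [Measure.prod_prod]
      exact ENNReal.mul_ne_top (box_fin _ _) (box_fin _ _)
    · have h1 := h.cont
      have h2 := ker_meas h μ
      apply Measurable.aestronglyMeasurable
      unfold yint
      apply Measurable.mul
      · fun_prop
      · apply Measurable.mul
        · apply Continuous.measurable
          unfold psi
          fun_prop
        · fun_prop
    · intro z
      exact yint_le h (psi_ampN h hc hb le_rfl hlam a b ξ z.1) _ _ _ _
    · intro z hz
      rw [Set.mem_prod, not_and_or] at hz
      have : psi χ₀ Θ lam a b ξ z.1 z.2 = 0 := by
        unfold psi
        rcases hz with hz | hz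
        · obtain ⟨k, hk⟩ := not_mem_box hz
          rw [prod_cut_zero h hlam a z.1 k hk]; simp
        · obtain ⟨k, hk⟩ := not_mem_box hz
          rw [prod_cut_zero h hlam b z.2 k hk]; simp
      unfold yint
      rw [this]; simp
  constructor
  · unfold oscInt
    simp_rw [osc_integrand_eq]
    exact integral_prod _ hi
  · exact hi.integral_prod_left

theorem ae_ne {d : ℕ} (j : Fin d) : ∀ᵐ x : Fin d → ℝ, x j ≠ 0 := by
  have := Measure.pi_hyperplane (fun _ : Fin d => (volume : Measure ℝ)) j 0
  rw [ae_iff]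
  simp only [ne_eq, not_not]
  exact this

theorem Fx_bound (h : Cut χ₀) {n : ℕ} {β : Fin (n+1) → ℝ} {m : ℝ} (hm : 0 < m) (hβ : ∀ k, m ≤ β k)
    {Θ : (Fin (n+1) → ℝ) × (Fin (n+1) → ℝ) → ℂ} {D S : ℝ}
    (hS : 0 ≤ S) (hSl : ∀ s t, |χ₀ s - χ₀ t| ≤ S * |s - t|)
    (hD : 0 ≤ D) (hd : Differentiable ℝ Θ) (hb : ∀ z, ‖Θ z‖ ≤ D)
    (hb' : ∀ j z, ‖fderiv ℝ Θ z (eyv (n+1) j)‖ ≤ D) {i j : Fin (n+1)} (hij : i ≠ j)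
    {lam : ℝ} (hlam : 1 ≤ lam) (a b ξ η : Fin (n+1) → ℝ) (μ : ℝ) (x : Fin (n+1) → ℝ)
    (hxi : x i ≠ 0) (hxj : x j ≠ 0) :
    ‖Fx χ₀ β Θ lam a b ξ η μ x‖ ≤
      ((2 * lam) ^ n * (m⁻¹ * (24 * ((1 + S) * D) * lam))) * ∏ k, wt lam (a k) (x k) := by
  have hQ : 0 ≤ (2 * lam) ^ n * (m⁻¹ * (24 * ((1 + S) * D) * lam)) := by positivity
  by_cases hx : x ∈ box a lam
  · have key : ∀ k, x k ≠ 0 → ‖Fx χ₀ β Θ lam a b ξ η μ x‖ ≤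
        ((2 * lam) ^ n * (m⁻¹ * (24 * ((1 + S) * D) * lam))) * |x k|⁻¹ := by
      intro k hk
      have hβk : 0 < β k := hm.trans_le (hβ k)
      refine (nD_bound h hlam
        (psi_ampN h hd.continuous hb (by nlinarith [mul_nonneg hS hD]) hlam a b ξ x) k
        (psi_amp h hS hSl hD hd hb k (hb' k) hlam a b ξ x) _ _ (by positivity) μ).trans ?_
      rw [abs_mul, abs_of_pos hβk, mul_inv]
      have : (β k)⁻¹ ≤ m⁻¹ := inv_anti₀ hm (hβ k)
      calc _ ≤ (2 * lam) ^ n * (m⁻¹ * |x k|⁻¹ * (24 * ((1 + S) * D) * lam)) := by gcongr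
        _ = _ := by ring
    refine (geo_mean (norm_nonneg _) hQ (abs_pos.mpr hxi) (abs_pos.mpr hxj)
      (key i hxi) (key j hxj)).trans ?_
    gcongr
    exact prod_wt_ge hx hij
  · obtain ⟨k, hk⟩ := not_mem_box hx
    have : ∀ y, psi χ₀ Θ lam a b ξ x y = 0 := by
      intro y
      unfold psi
      rw [prod_cut_zero h hlam a x k hk]; simp
    have h0 : Fx χ₀ β Θ lam a b ξ η μ x = 0 := by
      simp [Fx, yint, this]
    rw [h0, norm_zero]
    exact mul_nonneg hQ (Finset.prod_nonneg fun k _ => wt_nonneg _ _ _)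

theorem core (h : Cut χ₀) {n : ℕ} {β : Fin (n+1) → ℝ} {m : ℝ} (hm : 0 < m) (hβ : ∀ k, m ≤ β k)
    {Θ : (Fin (n+1) → ℝ) × (Fin (n+1) → ℝ) → ℂ} {D S : ℝ}
    (hS : 0 ≤ S) (hSl : ∀ s t, |χ₀ s - χ₀ t| ≤ S * |s - t|)
    (hD : 0 ≤ D) (hd : Differentiable ℝ Θ) (hb : ∀ z, ‖Θ z‖ ≤ D)
    (hb' : ∀ j z, ‖fderiv ℝ Θ z (eyv (n+1) j)‖ ≤ D) {i j : Fin (n+1)} (hij : i ≠ j)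
    {lam : ℝ} (hlam : 1 ≤ lam) (a b ξ η : Fin (n+1) → ℝ) :
    (∀ μ, ‖oscInt (n+1) β χ₀ Θ lam μ a b ξ η‖ ≤
      (2 ^ n * m⁻¹ * 24 * (1 + S) * (2 + c0) ^ (n+1)) * D * lam ^ (2 * (n+1))) ∧
    ∃ l, Tendsto (fun μ => oscInt (n+1) β χ₀ Θ lam μ a b ξ η) atTop (𝓝 l) := by
  set Q := (2 * lam) ^ n * (m⁻¹ * (24 * ((1 + S) * D) * lam)) with hQdef
  have hQ : 0 ≤ Q := by positivity
  have hwi : Integrable (fun x : Fin (n+1) → ℝ => Q * ∏ k, wt lam (a k) (x k)) :=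
    (Integrable.fintype_prod (f := fun k => wt lam (a k)) fun k => wt_integrable lam (a k)).const_mul Q
  have hae : ∀ μ, ∀ᵐ x, ‖Fx χ₀ β Θ lam a b ξ η μ x‖ ≤ Q * ∏ k, wt lam (a k) (x k) := by
    intro μ
    filter_upwards [ae_ne i, ae_ne j] with x h1 h2
    exact Fx_bound h hm hβ hS hSl hD hd hb hb' hij hlam a b ξ η μ x h1 h2
  constructor
  · intro μ
    rw [(osc_fubini h β hd.continuous hb hlam a b ξ η μ).1]
    refine (norm_integral_le_of_norm_le hwi (hae μ)).trans ?_
    rw [integral_const_mul, integral_fintype_prod_volume_eq_prod (f := fun k => wt lam (a k))]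
    have h1 : ∏ k, ∫ t, wt lam (a k) t ≤ ((2 + c0) * lam) ^ (n+1) := by
      refine (Finset.prod_le_prod (fun k _ => integral_nonneg (wt_nonneg lam (a k)))
        (fun k _ => wt_integral lam (a k) hlam)).trans ?_
      simp
    refine (mul_le_mul_of_nonneg_left h1 hQ).trans (le_of_eq ?_)
    rw [hQdef, mul_pow, mul_pow]
    ring
  · have hl : ∀ x : Fin (n+1) → ℝ, ∃ l, x i ≠ 0 →
        Tendsto (fun μ => Fx χ₀ β Θ lam a b ξ η μ x) atTop (𝓝 l) := by
      intro x
      by_cases hx : x i = 0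
      · exact ⟨0, fun h => absurd hx h⟩
      have hβi : 0 < β i := hm.trans_le (hβ i)
      obtain ⟨l, hl⟩ := nD_lim h hlam
        (psi_ampN h hd.continuous hb (by nlinarith [mul_nonneg hS hD]) hlam a b ξ x) i
        (psi_amp h hS hSl hD hd hb i (hb' i) hlam a b ξ x) (fun k => β k * x k)
        (fun k => 2 * Real.pi * η k) (by positivity)
      exact ⟨l, fun _ => hl⟩
    choose l hl using hl
    refine ⟨∫ x, l x, ?_⟩
    simp_rw [fun μ => (osc_fubini h β hd.continuous hb hlam a b ξ η μ).1]
    apply tendsto_integral_filter_of_dominated_convergence _ _ _ hwi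
    · filter_upwards [ae_ne i] with x hx
      exact hl x hx
    · exact Eventually.of_forall fun μ =>
        (osc_fubini h β hd.continuous hb hlam a b ξ η μ).2.aestronglyMeasurable
    · exact Eventually.of_forall hae

end Aux

/-- Lemma A.8 (1) of Deng–Hani: let `d ≥ 3`, `β ∈ (ℝ⁺)^d` and `χ₀` a fixed smooth cutoff
with values in `[0,1]`, equal to `1` on `[-1/2, 1/2]` and supported in `[-1, 1]`; set
`χ_∞ = 1 - χ₀`.  There is a constant `C = C(d, β, χ₀)` such that for every `D > 0`, every
`Θ : ℝ^d × ℝ^d → ℂ` whose mixed partial derivatives `∂_x^α ∂_y^γ Θ` of orders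
`|α|, |γ| ≤ 10d` exist, are continuous and bounded in norm by `D`, every `λ ≥ 1`, every
`μ > 1` and all `a, b, ξ, η ∈ ℝ^d`, the oscillatory integral above is bounded in absolute
value by `C D λ^{2d}`; moreover its limit as `μ → ∞` exists and has absolute value at most
`C D λ^{2d}`, uniformly in `(a, b, ξ, η)`. -/
theorem oscillatory_integral_bound (d : ℕ) (hd : 3 ≤ d) (β : Fin d → ℝ) (hβ : ∀ j, 0 < β j)
    (χ₀ : ℝ → ℝ) (hχs : ContDiff ℝ (⊤ : ℕ∞) χ₀)
    (hχ1 : ∀ t ∈ Set.Icc (-(1 : ℝ) / 2) (1 / 2), χ₀ t = 1)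
    (hχ0 : ∀ t ∉ Set.Icc (-1 : ℝ) 1, χ₀ t = 0)
    (hχr : ∀ t : ℝ, χ₀ t ∈ Set.Icc (0 : ℝ) 1) :
    ∃ C : ℝ, 0 < C ∧
      ∀ D : ℝ, 0 < D → ∀ Θ : (Fin d → ℝ) × (Fin d → ℝ) → ℂ,
        (∀ α γ : List (Fin d), α.length ≤ 10 * d → γ.length ≤ 10 * d →
          (∀ vs : List ((Fin d → ℝ) × (Fin d → ℝ)),
            vs <:+ (α.map (exv d) ++ γ.map (eyv d)) →
            vs ≠ α.map (exv d) ++ γ.map (eyv d) →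
            Differentiable ℝ (pdList Θ vs)) ∧
          Continuous (pdList Θ (α.map (exv d) ++ γ.map (eyv d))) ∧
          (∀ z, ‖pdList Θ (α.map (exv d) ++ γ.map (eyv d)) z‖ ≤ D)) →
        ∀ lam : ℝ, 1 ≤ lam →
          (∀ μ : ℝ, 1 < μ → ∀ a b ξ η : Fin d → ℝ,
            ‖oscInt d β χ₀ Θ lam μ a b ξ η‖ ≤ C * D * lam ^ (2 * d)) ∧
          (∀ a b ξ η : Fin d → ℝ, ∃ I : ℂ,
            Filter.Tendsto (fun μ : ℝ => oscInt d β χ₀ Θ lam μ a b ξ η)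
              Filter.atTop (nhds I) ∧
            ‖I‖ ≤ C * D * lam ^ (2 * d)) := by
  obtain ⟨n, rfl⟩ : ∃ n, d = n + 1 := ⟨d - 1, by omega⟩
  have hcut : Cut χ₀ :=
    { cont := hχs.continuous
      one := fun t ht => hχ1 t (by
        rw [abs_le] at ht; constructor <;> linarith [ht.1, ht.2])
      zero := fun t ht => hχ0 t (by
        intro hc
        have := abs_le.mpr ⟨hc.1, hc.2⟩
        linarith)
      nonneg := fun t => (hχr t).1
      le := fun t => (hχr t).2 }
  obtain ⟨S, hS⟩ : ∃ S, LipschitzWith S χ₀ :=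
    ContDiff.lipschitzWith_of_hasCompactSupport
      (HasCompactSupport.intro (K := Set.Icc (-1:ℝ) 1) isCompact_Icc (fun t ht => hχ0 t ht))
      hχs (by simp)
  have hSl : ∀ s t, |χ₀ s - χ₀ t| ≤ (S : ℝ) * |s - t| := by
    intro s t
    have := hS.dist_le_mul s t
    rwa [Real.dist_eq, Real.dist_eq] at this
  obtain ⟨k0, hk0⟩ := Finite.exists_min β
  have hc0 := c0_nonneg
  have hm := hβ k0
  have hS0 : (0:ℝ) ≤ S := S.2
  refine ⟨2 ^ n * (β k0)⁻¹ * 24 * (1 + S) * (2 + c0) ^ (n+1), by positivity, ?_⟩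
  intro D hD Θ hΘ lam hlam
  have hij : (⟨0, by omega⟩ : Fin (n+1)) ≠ ⟨1, by omega⟩ := by simp
  have hb : ∀ z, ‖Θ z‖ ≤ D := by
    have := (hΘ [] [] (by simp) (by simp)).2.2
    simpa [pdList] using this
  have hdiff : Differentiable ℝ Θ := by
    have := (hΘ [] [⟨0, by omega⟩] (by simp) (by simp; omega)).1 [] (by simp) (by simp)
    simpa [pdList] using this
  have hb' : ∀ j z, ‖fderiv ℝ Θ z (eyv (n+1) j)‖ ≤ D := by
    intro j
    have := (hΘ [] [j] (by simp) (by simp; omega)).2.2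
    simpa [pdList] using this
  have main := fun a b ξ η => core hcut hm hk0 hS0 hSl hD.le hdiff hb hb' hij hlam a b ξ η
  refine ⟨fun μ _ a b ξ η => (main a b ξ η).1 μ, fun a b ξ η => ?_⟩
  obtain ⟨l, hl⟩ := (main a b ξ η).2
  exact ⟨l, hl, le_of_tendsto hl.norm (Filter.Eventually.of_forall (main a b ξ η).1)⟩

end WKE
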